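/- arXiv:2605.13291 — 2 statements merged into one kernel-verified Lean document; each statement's English description precedes it below -/
import Mathlib

section
/- Let p < q < r be primes with p ∣ q−1 and p ∣ r−1, let a be a unit of ℤ/qℤ of multiplicative order p and b a unit of ℤ/rℤ of multiplicative order p. If 1 ≤ i, j ≤ p−1 and the groups G(pqr;a,b^i) and G(pqr;a,b^j) are isomorphic, then i = j. In particular, the p−1 groups G(pqr;a,b^1), …, G(pqr;a,b^{p−1}) are pairwise non-isomorphic. -/
/-- The automorphism of `ℤ/q × ℤ/r` (written multiplicatively) given by
multiplication by the unit `a` on the first factor and by the unit `b` on the second. -/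
def mulAutAB {q r : ℕ} (a : (ZMod q)ˣ) (b : (ZMod r)ˣ) :
    MulAut (Multiplicative (ZMod q × ZMod r)) :=
  AddEquiv.toMultiplicative
    ((DistribMulAction.toAddAut (ZMod q)ˣ (ZMod q) a).prodCongr
      (DistribMulAction.toAddAut (ZMod r)ˣ (ZMod r) b))

theorem mulAutAB_apply {q r : ℕ} (a : (ZMod q)ˣ) (b : (ZMod r)ˣ)
    (x : Multiplicative (ZMod q × ZMod r)) :
    mulAutAB a b x = Multiplicative.ofAdd ((a : ZMod q) * x.toAdd.1, (b : ZMod r) * x.toAdd.2) :=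
  rfl

theorem mulAutAB_pow {q r : ℕ} (a : (ZMod q)ˣ) (b : (ZMod r)ˣ) (k : ℕ) :
    mulAutAB a b ^ k = mulAutAB (a ^ k) (b ^ k) := by
  induction k with
  | zero =>
    ext x : 1
    simp [mulAutAB_apply]
  | succ k ih =>
    ext x : 1
    rw [pow_succ, ih, MulAut.mul_apply]
    simp [mulAutAB_apply, pow_succ, mul_assoc]

theorem SemidirectProduct.mul_inl_eq_inl_mul {N P : Type*} [CommGroup N] [Group P]
    {φ : P →* MulAut N} (s : N ⋊[φ] P) (y : N) :
    s * SemidirectProduct.inl y = SemidirectProduct.inl (φ s.right y) * s := by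
  ext <;> simp [mul_comm]

/-- An isomorphism of semidirect products `N ⋊ P` with `N` abelian carries an element of `N` of
order coprime to `|P|` to an element of `N`, and an eigenvector of the action to an eigenvector. -/
theorem SemidirectProduct.exists_map_inl_eq_inl {N P : Type*} [CommGroup N] [Group P]
    {φ₁ φ₂ : P →* MulAut N} (f : (N ⋊[φ₁] P) ≃* (N ⋊[φ₂] P)) {x : N} {n : ℕ} (hx : x ≠ 1)
    (hxn : x ^ n = 1) (hn : (Nat.card P).Coprime n) {t : P} {m : ℕ} (ht : φ₁ t x = x ^ m) :
    ∃ y : N, y ≠ 1 ∧ y ^ n = 1 ∧ φ₂ (f (SemidirectProduct.inr t)).right y = y ^ m := by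
  have hpow : f (SemidirectProduct.inl x) ^ n = 1 := by
    rw [← map_pow, ← map_pow, hxn, map_one, map_one]
  have hright : (f (SemidirectProduct.inl x)).right = 1 := by
    have h : (f (SemidirectProduct.inl x)).right ^ n = 1 := by
      rw [← SemidirectProduct.rightHom_eq_right, ← map_pow, hpow, map_one]
    exact orderOf_eq_one_iff.mp (Nat.eq_one_of_dvd_coprimes hn (orderOf_dvd_natCard _)
      (orderOf_dvd_of_pow_eq_one h))
  obtain ⟨y, hy⟩ : ∃ y, f (SemidirectProduct.inl x) = SemidirectProduct.inl y :=
    ⟨_, SemidirectProduct.ext rfl hright⟩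
  refine ⟨y, ?_, ?_, ?_⟩
  · rintro rfl
    rw [map_one, EmbeddingLike.map_eq_one_iff] at hy
    exact hx (SemidirectProduct.inl_injective (hy.trans (map_one _).symm))
  · rw [hy, ← map_pow] at hpow
    exact SemidirectProduct.inl_injective (hpow.trans (map_one _).symm)
  · have h := congrArg f (SemidirectProduct.mul_inl_eq_inl_mul
      (SemidirectProduct.inr t : N ⋊[φ₁] P) x)
    rw [SemidirectProduct.right_inr, ht, map_pow, map_mul, map_mul, map_pow, hy,
      SemidirectProduct.mul_inl_eq_inl_mul, ← map_pow] at h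
    exact SemidirectProduct.inl_injective (mul_right_cancel h)

theorem ZMod.eq_zero_of_prime_nsmul {q r : ℕ} (hq : q.Prime) (hr : r.Prime) (h : q ≠ r)
    {v : ZMod r} (hv : q • v = 0) : v = 0 := by
  have : Fact r.Prime := ⟨hr⟩
  rw [nsmul_eq_mul, mul_eq_zero, ZMod.natCast_eq_zero_iff] at hv
  exact hv.resolve_left fun hd => h ((Nat.prime_dvd_prime_iff_eq hr hq).mp hd).symm

/-- Let `p < q < r` be primes with `p ∣ q - 1`, `p ∣ r - 1`, let `a` be a unit of
`ℤ/q` of order `p` and `b` a unit of `ℤ/r` of order `p`.  If `1 ≤ i, j ≤ p - 1`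
and the groups `G(pqr; a, b^i)` and `G(pqr; a, b^j)` (the semidirect products
`(ℤ/q × ℤ/r) ⋊ ℤ/p` whose structure maps `φ₁`, `φ₂` send the generator `1` of
`ℤ/p` to multiplication by `(a, b^i)` resp. `(a, b^j)`) are isomorphic, then
`i = j`; in particular these `p - 1` groups are pairwise non-isomorphic. -/
theorem stmt_8 {p q r : ℕ} (hp : p.Prime) (hq : q.Prime) (hr : r.Prime)
    (hpq : p < q) (hqr : q < r) (hdq : p ∣ q - 1) (hdr : p ∣ r - 1)
    (a : (ZMod q)ˣ) (b : (ZMod r)ˣ) (ha : orderOf a = p) (hb : orderOf b = p)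
    (i j : ℕ) (hi1 : 1 ≤ i) (hi2 : i ≤ p - 1) (hj1 : 1 ≤ j) (hj2 : j ≤ p - 1)
    (φ₁ φ₂ : Multiplicative (ZMod p) →* MulAut (Multiplicative (ZMod q × ZMod r)))
    (hφ₁ : φ₁ (Multiplicative.ofAdd (1 : ZMod p)) = mulAutAB a (b ^ i))
    (hφ₂ : φ₂ (Multiplicative.ofAdd (1 : ZMod p)) = mulAutAB a (b ^ j))
    (hiso : Nonempty ((Multiplicative (ZMod q × ZMod r) ⋊[φ₁] Multiplicative (ZMod p)) ≃*
      (Multiplicative (ZMod q × ZMod r) ⋊[φ₂] Multiplicative (ZMod p)))) :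
    i = j := by
  obtain ⟨f⟩ := hiso
  have : Fact q.Prime := ⟨hq⟩
  have : Fact r.Prime := ⟨hr⟩
  have : NeZero p := ⟨hp.ne_zero⟩
  have hcard : Nat.card (Multiplicative (ZMod p)) = p := Nat.card_zmod p
  set t : Multiplicative (ZMod p) := Multiplicative.ofAdd 1
  have hx : (Multiplicative.ofAdd ((1 : ZMod q), (0 : ZMod r))) ≠ 1 := fun h =>
    one_ne_zero (congrArg (fun z => z.toAdd.1) h)
  have hx' : (Multiplicative.ofAdd ((0 : ZMod q), (1 : ZMod r))) ≠ 1 := fun h =>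
    one_ne_zero (congrArg (fun z => z.toAdd.2) h)
  obtain ⟨y, hy1, hyq, hyt⟩ := SemidirectProduct.exists_map_inl_eq_inl f (n := q) (t := t)
    (m := (a : ZMod q).val) hx (by simp [← ofAdd_nsmul])
    (by rw [hcard]; exact (Nat.coprime_primes hp hq).mpr hpq.ne)
    (by rw [hφ₁, mulAutAB_apply, ← ofAdd_nsmul]; simp)
  obtain ⟨z, hz1, hzr, hzt⟩ := SemidirectProduct.exists_map_inl_eq_inl f (n := r) (t := t)
    (m := ((b ^ i : (ZMod r)ˣ) : ZMod r).val) hx' (by simp [← ofAdd_nsmul])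
    (by rw [hcard]; exact (Nat.coprime_primes hp hr).mpr (hpq.trans hqr).ne)
    (by rw [hφ₁, mulAutAB_apply, ← ofAdd_nsmul]; simp)
  obtain ⟨k, hk⟩ : ∃ k : ℕ, (f (SemidirectProduct.inr t)).right = t ^ k :=
    ⟨(f (SemidirectProduct.inr t)).right.toAdd.val, by
      rw [← ofAdd_nsmul, nsmul_one, ZMod.natCast_zmod_val, ofAdd_toAdd]⟩
  rw [hk, map_pow, hφ₂, mulAutAB_pow, mulAutAB_apply] at hyt hzt
  have hy2 : y.toAdd.2 = 0 := ZMod.eq_zero_of_prime_nsmul hq hr hqr.ne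
    (congrArg (fun z => z.toAdd.2) hyq)
  have hz2 : z.toAdd.1 = 0 := ZMod.eq_zero_of_prime_nsmul hr hq hqr.ne'
    (congrArg (fun z => z.toAdd.1) hzr)
  have hy0 : y.toAdd.1 ≠ 0 := fun h => hy1 (Multiplicative.toAdd.injective (Prod.ext h hy2))
  have hz0 : z.toAdd.2 ≠ 0 := fun h => hz1 (Multiplicative.toAdd.injective (Prod.ext hz2 h))
  have hak : a ^ k = a := by
    have h := congrArg (fun z => z.toAdd.1) hyt
    simp only [toAdd_ofAdd, toAdd_pow, nsmul_eq_mul, Prod.fst_mul, Prod.fst_natCast,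
      ZMod.natCast_zmod_val] at h
    exact Units.ext (mul_right_cancel₀ hy0 h)
  have hbk : (b ^ j) ^ k = b ^ i := by
    have h := congrArg (fun z => z.toAdd.2) hzt
    simp only [toAdd_ofAdd, toAdd_pow, nsmul_eq_mul, Prod.snd_mul, Prod.snd_natCast,
      ZMod.natCast_zmod_val] at h
    exact Units.ext (mul_right_cancel₀ hz0 h)
  have hk1 : k ≡ 1 [MOD p] := by
    rw [← ha, ← pow_eq_pow_iff_modEq, hak, pow_one]
  have hij : j * k ≡ i [MOD p] := by
    rw [← hb, ← pow_eq_pow_iff_modEq, pow_mul, hbk]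
  have hji : j ≡ i [MOD p] := by simpa using (hk1.mul_left j).symm.trans hij
  exact (hji.eq_of_lt_of_lt (by omega) (by omega)).symm
end

section
/- Let p < q < r be primes. The number of isomorphism classes of finite groups G of order p·q·r such that G has weight one and the commutator subgroup [G,G] does not have prime-power order equals p−1 if p divides both q−1 and r−1, and equals 0 otherwise. -/
/-- The multiplication underlying a group structure `s` on a type `α`. -/
def groupMul {α : Type*} (s : Group α) : Mul α := by letI := s; infer_instance

/-- The setoid identifying isomorphic group structures (satisfying a predicate `P`)
on the carrier `Fin n`; its quotient is the set of isomorphism classes of groups of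
order `n` satisfying `P`. -/
def isoSetoid {n : ℕ} (P : Group (Fin n) → Prop) : Setoid {s : Group (Fin n) // P s} where
  r s t := Nonempty (@MulEquiv (Fin n) (Fin n) (groupMul s.1) (groupMul t.1))
  iseqv := by
    refine ⟨fun s => ⟨@MulEquiv.refl _ (groupMul s.1)⟩, ?_, ?_⟩
    · rintro s t ⟨e⟩
      exact ⟨@MulEquiv.symm _ _ (groupMul s.1) (groupMul t.1) e⟩
    · rintro s t u ⟨e⟩ ⟨f⟩
      exact ⟨@MulEquiv.trans _ _ _ (groupMul s.1) (groupMul t.1) (groupMul u.1) e f⟩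

/-- The units of `R` act on the additive group of `R` by multiplication. -/
def unitsMulAut (R : Type*) [CommRing R] : Rˣ →* MulAut (Multiplicative R) where
  toFun u :=
    { toFun := fun t => Multiplicative.ofAdd ((u : R) * t.toAdd)
      invFun := fun t => Multiplicative.ofAdd (((u⁻¹ : Rˣ) : R) * t.toAdd)
      left_inv := fun t => by simp
      right_inv := fun t => by simp
      map_mul' := fun s t => by simp [mul_add] }
  map_one' := by ext; simp
  map_mul' u v := by ext; simp [mul_assoc]

theorem unitsMulAut_apply {R : Type*} [CommRing R] (u : Rˣ) (t : Multiplicative R) :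
    unitsMulAut R u t = Multiplicative.ofAdd ((u : R) * t.toAdd) := rfl

theorem unitsMulAut_injective (R : Type*) [CommRing R] :
    Function.Injective (unitsMulAut R) := by
  intro u v h
  have := DFunLike.congr_fun h (Multiplicative.ofAdd 1)
  simpa [unitsMulAut_apply, Units.ext_iff] using this

theorem unitsMulAut_surjective {R : Type*} [CommRing R]
    (hR : Function.Surjective (Nat.cast : ℕ → R)) :
    Function.Surjective (unitsMulAut R) := by
  have key (f : MulAut (Multiplicative R)) (x : R) :
      (f (Multiplicative.ofAdd x)).toAdd = (f (Multiplicative.ofAdd 1)).toAdd * x := by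
    obtain ⟨n, rfl⟩ := hR x
    have : Multiplicative.ofAdd (n : R) = Multiplicative.ofAdd (1 : R) ^ n := by
      rw [← ofAdd_nsmul, nsmul_one]
    rw [this, map_pow, toAdd_pow, nsmul_eq_mul, mul_comm]
  intro f
  refine ⟨⟨(f (Multiplicative.ofAdd 1)).toAdd, (f⁻¹ (Multiplicative.ofAdd 1)).toAdd, ?_, ?_⟩, ?_⟩
  · rw [← key, ofAdd_toAdd, MulAut.apply_inv_self, toAdd_ofAdd]
  · rw [← key, ofAdd_toAdd, MulAut.inv_apply_self, toAdd_ofAdd]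
  · ext t
    exact (key f t.toAdd).symm

/-- The group of affine transformations `x ↦ u * x + t` of `R` with `u ∈ L`. -/
abbrev AffineGroup {R : Type*} [CommRing R] (L : Subgroup Rˣ) : Type _ :=
  Multiplicative R ⋊[(unitsMulAut R).comp L.subtype] L

theorem map_mem_commutator {G H : Type*} [Group G] [Group H] (f : G →* H) {x : G}
    (hx : x ∈ commutator G) : f x ∈ commutator H := by
  have h : (commutator G).map f ≤ commutator H := by
    rw [map_commutator_eq, commutator_def]
    exact Subgroup.commutator_mono le_top le_top
  exact h (Subgroup.mem_map_of_mem f hx)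

namespace AffineGroup

open SemidirectProduct

variable {R : Type*} [CommRing R] {L : Subgroup Rˣ}

theorem commutator_le_range_inl :
    commutator (AffineGroup L) ≤ (inl : Multiplicative R →* AffineGroup L).range := by
  rw [range_inl_eq_ker_rightHom]
  exact Abelianization.commutator_subset_ker _

theorem conj_inl (g : AffineGroup L) (t : Multiplicative R) :
    g * inl t * g⁻¹ = inl (Multiplicative.ofAdd (((g.right : Rˣ) : R) * t.toAdd)) := by
  rw [mul_inv_eq_iff_eq_mul]
  ext <;> simp [unitsMulAut_apply, add_comm]

theorem exists_conj_mul_inv_eq_inl {u : Rˣ} (hu : u ∈ L) (h : IsUnit ((u : R) - 1))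
    (t : Multiplicative R) :
    ∃ s : Multiplicative R,
      (inr ⟨u, hu⟩ : AffineGroup L) * inl s * (inr ⟨u, hu⟩)⁻¹ * (inl s)⁻¹ = inl t := by
  obtain ⟨v, hv⟩ := h
  refine ⟨Multiplicative.ofAdd (((v⁻¹ : Rˣ) : R) * t.toAdd), ?_⟩
  rw [conj_inl, ← map_inv, ← map_mul]
  congr 1
  apply Multiplicative.toAdd.injective
  simp only [right_inr, toAdd_ofAdd, toAdd_mul, toAdd_inv]
  have : (v : R) * ((v⁻¹ : Rˣ) : R) = 1 := by simp
  rw [hv] at this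
  linear_combination t.toAdd * this

theorem commutator_eq_range_inl (h : ∃ u ∈ L, IsUnit ((u : R) - 1)) :
    commutator (AffineGroup L) = (inl : Multiplicative R →* AffineGroup L).range := by
  obtain ⟨u, hu, h⟩ := h
  refine le_antisymm commutator_le_range_inl ?_
  rintro _ ⟨t, rfl⟩
  obtain ⟨s, hs⟩ := exists_conj_mul_inv_eq_inl hu h t
  rw [← hs, commutator_def]
  exact Subgroup.commutator_mem_commutator (Subgroup.mem_top _) (Subgroup.mem_top _)

theorem card_range_inl :
    Nat.card (inl : Multiplicative R →* AffineGroup L).range = Nat.card R :=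
  (Nat.card_congr (MonoidHom.ofInjective inl_injective).toEquiv).symm

theorem normalClosure_inr_eq_top {u : Rˣ} (hu : u ∈ L) (hL : L ≤ Subgroup.zpowers u)
    (h : IsUnit ((u : R) - 1)) :
    Subgroup.normalClosure {(inr ⟨u, hu⟩ : AffineGroup L)} = ⊤ := by
  set N := Subgroup.normalClosure {(inr ⟨u, hu⟩ : AffineGroup L)}
  have hN : (inr ⟨u, hu⟩ : AffineGroup L) ∈ N := Subgroup.subset_normalClosure rfl
  rw [eq_top_iff]
  intro g _
  rw [← inl_left_mul_inr_right g]
  refine N.mul_mem ?_ ?_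
  · obtain ⟨s, hs⟩ := exists_conj_mul_inv_eq_inl hu h g.left
    rw [← hs, mul_assoc, mul_assoc, ← mul_assoc (inl s)]
    exact N.mul_mem hN (Subgroup.normalClosure_normal.conj_mem _ (N.inv_mem hN) _)
  · obtain ⟨n, hn⟩ := Subgroup.mem_zpowers_iff.mp (hL g.right.2)
    have : g.right = (⟨u, hu⟩ : L) ^ n := Subtype.ext (by simp [hn])
    rw [this, map_zpow]
    exact N.zpow_mem hN n

theorem le_of_mulEquiv (hR : Function.Surjective (Nat.cast : ℕ → R)) {L' : Subgroup Rˣ}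
    (h' : ∃ u ∈ L', IsUnit ((u : R) - 1)) (e : AffineGroup L ≃* AffineGroup L') :
    L ≤ L' := by
  intro l hl
  obtain ⟨m, hm⟩ := hR (l : R)
  set g := e (inr ⟨l, hl⟩) with hg
  have hy : (inl (Multiplicative.ofAdd (1 : R)) : AffineGroup L') ∈
      commutator (AffineGroup L') := by
    rw [commutator_eq_range_inl h']
    exact ⟨_, rfl⟩
  obtain ⟨x, hx⟩ := commutator_le_range_inl (map_mem_commutator e.symm.toMonoidHom hy)
  replace hx : inl x = e.symm (inl (Multiplicative.ofAdd (1 : R))) := hx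
  have hconj : (inr ⟨l, hl⟩ : AffineGroup L) * inl x * (inr ⟨l, hl⟩)⁻¹ = (inl x) ^ m := by
    rw [conj_inl, ← map_pow]
    congr 1
    apply Multiplicative.toAdd.injective
    simp [← hm]
  have := congrArg e hconj
  rw [map_mul, map_mul, map_inv, map_pow, hx, MulEquiv.apply_symm_apply, ← hg, conj_inl,
    ← map_pow] at this
  have hgl : ((g.right : Rˣ) : R) = l := by
    simpa [← hm] using congrArg Multiplicative.toAdd (inl_injective this)
  rw [← Units.ext hgl]
  exact g.right.2

theorem isUnit_sub_one_of_card_commutator [Finite R] {u : Rˣ} (hu : L ≤ Subgroup.zpowers u)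
    (hc : Nat.card (commutator (AffineGroup L)) = Nat.card R) : IsUnit ((u : R) - 1) := by
  have hL : ∀ l ∈ L, (l : R) - 1 ∈ Ideal.span {(u : R) - 1} := by
    intro l hl
    obtain ⟨n, rfl⟩ := mem_powers_iff_mem_zpowers.mpr (hu hl)
    rw [Ideal.mem_span_singleton]
    simpa using sub_dvd_pow_sub_pow (u : R) 1 n
  have : Finite (inl : Multiplicative R →* AffineGroup L).range :=
    Nat.finite_of_card_ne_zero (by rw [card_range_inl]; exact Nat.card_pos.ne')
  have hcomm : commutator (AffineGroup L) = (inl : Multiplicative R →* AffineGroup L).range :=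
    Subgroup.eq_of_le_of_card_ge commutator_le_range_inl (by rw [hc, card_range_inl])
  let f : AffineGroup L →* Multiplicative (R ⧸ Ideal.span {(u : R) - 1}) :=
    { toFun := fun g => Multiplicative.ofAdd (Ideal.Quotient.mk _ g.left.toAdd)
      map_one' := by simp
      map_mul' := fun g h => by
        rw [← ofAdd_add, ← map_add]
        congr 1
        rw [Ideal.Quotient.mk_eq_mk_iff_sub_mem]
        simp only [mul_left, toAdd_mul, MonoidHom.comp_apply, unitsMulAut_apply, toAdd_ofAdd,
          Subgroup.coe_subtype]
        convert Ideal.mul_mem_right h.left.toAdd _ (hL _ g.right.2) using 1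
        ring }
  have h1 := Abelianization.commutator_subset_ker f
  rw [hcomm] at h1
  have h2 : f (inl (Multiplicative.ofAdd 1)) = 1 := h1 ⟨_, rfl⟩
  have h3 : (1 : R) ∈ Ideal.span {(u : R) - 1} := Ideal.Quotient.eq_zero_iff_mem.mp h2
  exact isUnit_of_dvd_one (Ideal.mem_span_singleton.mp h3)

end AffineGroup

section Counting

variable {K F : Type*} [Field K] [Field F]

theorem isUnit_sub_one_iff (u : (K × F)ˣ) :
    IsUnit ((u : K × F) - 1) ↔
      (MulEquiv.prodUnits u).1 ≠ 1 ∧ (MulEquiv.prodUnits u).2 ≠ 1 := by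
  rw [Prod.isUnit_iff, isUnit_iff_ne_zero, isUnit_iff_ne_zero, Prod.fst_sub, Prod.snd_sub,
    sub_ne_zero, sub_ne_zero, ne_eq, ne_eq, ne_eq, ne_eq, Units.ext_iff, Units.ext_iff]
  rfl

theorem orderOf_prodUnits_of_mem {p : ℕ} [Fact p.Prime] {L : Subgroup (K × F)ˣ}
    (hL : Nat.card L = p) {u : (K × F)ˣ} (hu : u ∈ L) (h : IsUnit ((u : K × F) - 1)) :
    orderOf (MulEquiv.prodUnits u).1 = p ∧ orderOf (MulEquiv.prodUnits u).2 = p := by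
  have hup : u ^ p = 1 := by
    have := pow_card_eq_one' (x := (⟨u, hu⟩ : L))
    rw [hL] at this
    simpa using congrArg Subtype.val this
  have hup' : MulEquiv.prodUnits u ^ p = 1 := by rw [← map_pow, hup, map_one]
  rw [isUnit_sub_one_iff] at h
  exact ⟨orderOf_eq_prime (by rw [← Prod.pow_fst, hup', Prod.fst_one]) h.1,
    orderOf_eq_prime (by rw [← Prod.pow_snd, hup', Prod.snd_one]) h.2⟩

theorem card_subgroup_eq_sub_one {p : ℕ} [Fact p.Prime] [Finite F]
    {a : Kˣ} (ha : orderOf a = p) (hF : p ∣ Nat.card F - 1) :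
    Nat.card {L : Subgroup (K × F)ˣ // Nat.card L = p ∧ ∃ u ∈ L, IsUnit ((u : K × F) - 1)} =
      p - 1 := by
  classical
  have hp : p.Prime := Fact.out
  have := Fintype.ofFinite F
  have hcard : Nat.card {c : Fˣ // orderOf c = p} = p - 1 := by
    rw [Nat.card_eq_fintype_card, Fintype.card_subtype, IsCyclic.card_orderOf_eq_totient,
      Nat.totient_prime hp]
    rwa [← Nat.card_eq_fintype_card, Nat.card_units]
  let w (c : Fˣ) : (K × F)ˣ := MulEquiv.prodUnits.symm (a, c)
  have hw (c : Fˣ) : MulEquiv.prodUnits (w c) = (a, c) := MulEquiv.apply_symm_apply _ _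
  have hworder {c : Fˣ} (hc : orderOf c = p) : orderOf (w c) = p := by
    rw [← MulEquiv.orderOf_eq MulEquiv.prodUnits, hw, Prod.orderOf_mk, ha, hc, Nat.lcm_self]
  have hwunit {c : Fˣ} (hc : orderOf c = p) : IsUnit ((w c : K × F) - 1) := by
    rw [isUnit_sub_one_iff, hw]
    constructor
    · rintro rfl
      exact hp.one_lt.ne (by rw [← ha, orderOf_one])
    · rintro rfl
      exact hp.one_lt.ne (by rw [← hc, orderOf_one])
  rw [← hcard]
  symm
  refine Nat.card_congr (Equiv.ofBijective (fun c => ⟨Subgroup.zpowers (w c.1),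
    by rw [Nat.card_zpowers, hworder c.2], w c.1, Subgroup.mem_zpowers _, hwunit c.2⟩) ⟨?_, ?_⟩)
  · rintro ⟨c, hc⟩ ⟨d, hd⟩ h
    have hmem : w c ∈ Subgroup.zpowers (w d) := by
      have h' : Subgroup.zpowers (w c) = Subgroup.zpowers (w d) := congrArg Subtype.val h
      exact h' ▸ Subgroup.mem_zpowers _
    obtain ⟨i, hi⟩ := Subgroup.mem_zpowers_iff.mp hmem
    have hi' := congrArg MulEquiv.prodUnits hi
    rw [map_zpow, hw, hw, Prod.pow_mk, Prod.mk.injEq] at hi'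
    have h1 : a ^ (i - 1) = 1 := by rw [zpow_sub_one, hi'.1, mul_inv_cancel]
    rw [← orderOf_dvd_iff_zpow_eq_one, ha, ← hd, orderOf_dvd_iff_zpow_eq_one, zpow_sub_one,
      hi'.2, mul_inv_eq_one] at h1
    exact Subtype.ext h1
  · rintro ⟨L, hL, u, hu, h⟩
    obtain ⟨h1, h2⟩ := orderOf_prodUnits_of_mem hL hu h
    have hprim : IsPrimitiveRoot (MulEquiv.prodUnits u).1 p := by
      rw [← h1]
      exact IsPrimitiveRoot.orderOf _
    have hprim' : IsPrimitiveRoot a p := by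
      rw [← ha]
      exact IsPrimitiveRoot.orderOf _
    have : NeZero p := ⟨hp.ne_zero⟩
    have hmem : a ∈ Subgroup.zpowers (MulEquiv.prodUnits u).1 := by
      rw [hprim.zpowers_eq, ← hprim'.zpowers_eq]
      exact Subgroup.mem_zpowers a
    obtain ⟨i, hi⟩ := Subgroup.mem_zpowers_iff.mp hmem
    set c := (MulEquiv.prodUnits u).2 ^ i with hcdef
    have hc : orderOf c = p := by
      refine orderOf_eq_prime ?_ fun hc1 => ?_
      · rw [hcdef, ← zpow_natCast, zpow_comm, zpow_natCast, ← h2, pow_orderOf_eq_one, one_zpow]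
      · rw [hcdef, ← orderOf_dvd_iff_zpow_eq_one, h2, ← h1, orderOf_dvd_iff_zpow_eq_one, hi] at hc1
        rw [hc1, orderOf_one] at ha
        exact hp.one_lt.ne ha
    have hwu : w c = u ^ i := by
      apply MulEquiv.prodUnits.injective
      rw [hw, map_zpow]
      exact Prod.ext hi.symm rfl
    refine ⟨⟨c, hc⟩, Subtype.ext ?_⟩
    have : Finite L := Nat.finite_of_card_ne_zero (by rw [hL]; exact hp.ne_zero)
    refine Subgroup.eq_of_le_of_card_ge ?_ ?_
    · rw [Subgroup.zpowers_le, hwu]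
      exact L.zpow_mem hu i
    · rw [hL, Nat.card_zpowers, hworder hc]

theorem card_subgroup_isUnit_sub_one (K F : Type*) [Field K] [Field F] [Finite K] [Finite F]
    {p : ℕ} (hp : p.Prime) :
    Nat.card {L : Subgroup (K × F)ˣ // Nat.card L = p ∧ ∃ u ∈ L, IsUnit ((u : K × F) - 1)} =
      if p ∣ Nat.card K - 1 ∧ p ∣ Nat.card F - 1 then p - 1 else 0 := by
  have := Fact.mk hp
  split_ifs with h
  · obtain ⟨a, ha⟩ := exists_prime_orderOf_dvd_card' (G := Kˣ) p
      (by rw [Nat.card_units]; exact h.1)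
    exact card_subgroup_eq_sub_one ha h.2
  · rw [Nat.card_eq_zero]
    left
    constructor
    rintro ⟨L, hL, u, hu, hu1⟩
    obtain ⟨h1, h2⟩ := orderOf_prodUnits_of_mem hL hu hu1
    refine h ⟨?_, ?_⟩
    · rw [← h1, ← Nat.card_units]
      exact orderOf_dvd_natCard _
    · rw [← h2, ← Nat.card_units]
      exact orderOf_dvd_natCard _

end Counting

section Structure

variable {G : Type*} [Group G] {p q r : ℕ}

theorem squarefree_mul_mul (hp : p.Prime) (hq : q.Prime) (hr : r.Prime)
    (hpq : p < q) (hqr : q < r) : Squarefree (p * q * r) := by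
  have hpr := hpq.trans hqr
  rw [Nat.squarefree_mul (Nat.Coprime.mul_left ((Nat.coprime_primes hp hr).mpr hpr.ne)
    ((Nat.coprime_primes hq hr).mpr hqr.ne)), Nat.squarefree_mul
    ((Nat.coprime_primes hp hq).mpr hpq.ne)]
  exact ⟨⟨hp.squarefree, hq.squarefree⟩, hr.squarefree⟩

theorem minFac_mul_mul (hp : p.Prime) (hq : q.Prime) (hr : r.Prime)
    (hpq : p < q) (hqr : q < r) : (p * q * r).minFac = p := by
  refine le_antisymm (Nat.minFac_le_of_dvd hp.two_le ⟨q * r, by ring⟩) ?_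
  have h1 : p * q * r ≠ 1 := fun h => hr.one_lt.ne' (Nat.eq_one_of_mul_eq_one_left h)
  have hprime := Nat.minFac_prime h1
  have hdvd := Nat.minFac_dvd (p * q * r)
  rcases (Nat.Prime.dvd_mul hprime).mp hdvd with h | h
  · rcases (Nat.Prime.dvd_mul hprime).mp h with h | h
    · exact ((Nat.prime_dvd_prime_iff_eq hprime hp).mp h).ge
    · exact hpq.le.trans ((Nat.prime_dvd_prime_iff_eq hprime hq).mp h).ge
  · exact (hpq.trans hqr).le.trans ((Nat.prime_dvd_prime_iff_eq hprime hr).mp h).ge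

theorem not_minFac_dvd_card_commutator [Finite G] [IsZGroup G] (hp : p.Prime)
    (hG : (Nat.card G).minFac = p) : ¬ p ∣ Nat.card (commutator G) := by
  have := Fact.mk hp
  let P : Sylow p G := default
  have hP : IsCyclic P := inferInstance
  have hN := IsCyclic.normalizer_le_centralizer hG hP
  refine fun h => MonoidHom.not_dvd_card_ker_transferSylow P hN
    (h.trans (Subgroup.card_dvd_of_le ?_))
  rw [commutator_def, Subgroup.commutator_le]
  intro x _ y _
  rw [MonoidHom.mem_ker, map_commutatorElement, commutatorElement_eq_one_iff_mul_comm]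
  let _ := IsCyclic.commGroup (α := P)
  exact mul_comm (G := P) _ _

theorem card_commutator_eq_mul (hp : p.Prime) (hq : q.Prime) (hr : r.Prime)
    (hpq : p < q) (hqr : q < r) (hG : Nat.card G = p * q * r)
    (hnot : ¬ ∃ u k : ℕ, u.Prime ∧ Nat.card (commutator G) = u ^ k) :
    Nat.card (commutator G) = q * r := by
  have hsq : Squarefree (Nat.card G) := hG ▸ squarefree_mul_mul hp hq hr hpq hqr
  have : Finite G := Nat.finite_of_card_ne_zero hsq.ne_zero
  have := IsZGroup.of_squarefree hsq
  have hdvd : Nat.card (commutator G) ∣ q * r := by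
    have h1 : Nat.card (commutator G) ∣ p * (q * r) := by
      rw [← mul_assoc, ← hG]
      exact Subgroup.card_subgroup_dvd_card _
    refine Nat.Coprime.dvd_of_dvd_mul_left ?_ h1
    rw [Nat.coprime_comm, hp.coprime_iff_not_dvd]
    exact not_minFac_dvd_card_commutator hp (hG ▸ minFac_mul_mul hp hq hr hpq hqr)
  obtain ⟨a, b, ha, hb, hab⟩ := Nat.dvd_mul.mp hdvd
  rcases (Nat.dvd_prime hq).mp ha with rfl | rfl
  · rcases (Nat.dvd_prime hr).mp hb with rfl | rfl
    · exact absurd ⟨p, 0, hp, by rw [← hab]; simp⟩ hnot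
    · exact absurd ⟨b, 1, hr, by rw [← hab]; simp⟩ hnot
  · rcases (Nat.dvd_prime hr).mp hb with rfl | rfl
    · exact absurd ⟨a, 1, hq, by rw [← hab]; simp⟩ hnot
    · exact hab.symm

theorem natCast_surjective_zmod_prod [NeZero q] [NeZero r] (h : q.Coprime r) :
    Function.Surjective (Nat.cast : ℕ → ZMod q × ZMod r) := by
  intro x
  obtain ⟨n, hn⟩ := ZMod.natCast_zmod_surjective ((ZMod.chineseRemainder h).symm x)
  exact ⟨n, by rw [← map_natCast (ZMod.chineseRemainder h), hn, RingEquiv.apply_symm_apply]⟩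

theorem commutator_semidirectProduct_one {N H : Type*} [Group N] [Group H]
    [IsMulCommutative N] [IsMulCommutative H] :
    commutator (N ⋊[(1 : H →* MulAut N)] H) = ⊥ := by
  rw [commutator_eq_bot_iff, isMulCommutative_iff]
  intro x y
  ext
  · exact isMulCommutative_iff.mp ‹_› x.left y.left
  · exact isMulCommutative_iff.mp ‹_› x.right y.right

theorem card_commutator_congr {G H : Type*} [Group G] [Group H] (e : G ≃* H) :
    Nat.card (commutator G) = Nat.card (commutator H) :=
  Nat.card_congr
    { toFun := fun x => ⟨e x, map_mem_commutator e.toMonoidHom x.2⟩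
      invFun := fun x => ⟨e.symm x, map_mem_commutator e.symm.toMonoidHom x.2⟩
      left_inv := fun x => by simp
      right_inv := fun x => by simp }

theorem exists_semidirectProduct_mulEquiv_affineGroup {R : Type*} [CommRing R]
    (hR : Function.Surjective (Nat.cast : ℕ → R)) {N H : Type*} [Group N] [Group H]
    [Fact (Nat.card H).Prime] (e : N ≃* Multiplicative R) {φ : H →* MulAut N} (hφ : φ ≠ 1) :
    ∃ L : Subgroup Rˣ, Nat.card L = Nat.card H ∧ Nonempty (N ⋊[φ] H ≃* AffineGroup L) := by
  let α : Rˣ ≃* MulAut (Multiplicative R) :=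
    MulEquiv.ofBijective (unitsMulAut R) ⟨unitsMulAut_injective R, unitsMulAut_surjective hR⟩
  have hα (u : Rˣ) : α u = unitsMulAut R u := rfl
  let β : MulAut N ≃* Rˣ := (MulAut.congr e).trans α.symm
  let ψ : H →* Rˣ := β.toMonoidHom.comp φ
  have hψ : Function.Injective ψ := by
    rw [← MonoidHom.ker_eq_bot_iff]
    refine ψ.ker.eq_bot_or_eq_top_of_prime_card.resolve_right fun h => hφ ?_
    ext1 x
    apply β.injective
    have hx : x ∈ ψ.ker := h ▸ Subgroup.mem_top x
    rw [MonoidHom.one_apply, map_one]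
    exact hx
  refine ⟨ψ.range, (Nat.card_congr (MonoidHom.ofInjective hψ).toEquiv).symm,
    ⟨SemidirectProduct.congr e (MonoidHom.ofInjective hψ) fun g => ?_⟩⟩
  have h : unitsMulAut R (ψ g) = MulAut.congr e (φ g) := by
    rw [← hα]
    exact α.apply_symm_apply _
  ext n
  change e (φ g n) = unitsMulAut R (ψ g) (e n)
  rw [h]
  simp [MulAut.congr]

theorem exists_mulEquiv_affineGroup (hp : p.Prime) {R : Type*} [CommRing R] [Finite R]
    (hR : Function.Surjective (Nat.cast : ℕ → R)) [IsCyclic (commutator G)]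
    (hG : Nat.card G = p * Nat.card R) (hc : Nat.card (commutator G) = Nat.card R)
    (hco : p.Coprime (Nat.card R)) (hR1 : Nat.card R ≠ 1) :
    ∃ L : Subgroup Rˣ, Nat.card L = p ∧ Nonempty (G ≃* AffineGroup L) := by
  have hindex : (commutator G).index = p := by
    have := (commutator G).card_mul_index
    rw [hG, hc, mul_comm] at this
    exact Nat.eq_of_mul_eq_mul_right Nat.card_pos this
  obtain ⟨H, hH⟩ := Subgroup.exists_right_complement'_of_coprime (N := commutator G)
    (by rw [hindex, hc]; exact hco.symm)
  have hHcard : Nat.card H = p := by rw [← hindex, hH.symm.index_eq_card]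
  have : Fact (Nat.card H).Prime := ⟨hHcard ▸ hp⟩
  have : IsCyclic H := isCyclic_of_prime_card (p := Nat.card H) rfl
  have : IsCyclic (Multiplicative R) := by
    refine isCyclic_of_surjective (G' := Multiplicative ℤ)
      (AddMonoidHom.toMultiplicative (Int.castAddHom R)) fun x => ?_
    obtain ⟨n, hn⟩ := hR x.toAdd
    exact ⟨Multiplicative.ofAdd (n : ℤ), Multiplicative.toAdd.injective (by simp [hn])⟩
  have key {φ : H →* MulAut (commutator G)} (E : commutator G ⋊[φ] H ≃* G) :
      ∃ L : Subgroup Rˣ, Nat.card L = p ∧ Nonempty (G ≃* AffineGroup L) := by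
    have hφ : φ ≠ 1 := by
      rintro rfl
      refine hR1 ?_
      rw [← hc, ← card_commutator_congr E, commutator_semidirectProduct_one, Subgroup.card_bot]
    obtain ⟨L, hL, ⟨f⟩⟩ := exists_semidirectProduct_mulEquiv_affineGroup hR
      (mulEquivOfCyclicCardEq hc) hφ
    exact ⟨L, hL.trans hHcard, ⟨E.symm.trans f⟩⟩
  exact key (SemidirectProduct.mulEquivSubgroup hH)

theorem exists_normalClosure_singleton_eq_top_of_mulEquiv {G H : Type*} [Group G] [Group H]
    (e : G ≃* H) (h : ∃ g : G, Subgroup.normalClosure {g} = ⊤) :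
    ∃ g : H, Subgroup.normalClosure {g} = ⊤ := by
  obtain ⟨g, hg⟩ := h
  refine ⟨e g, ?_⟩
  have := Subgroup.map_normalClosure {g} e.toMonoidHom e.surjective
  rw [hg, ← MonoidHom.range_eq_map, MonoidHom.range_eq_top.mpr e.surjective] at this
  simpa using this.symm

end Structure

section Classification

variable {p q r : ℕ}

/-- `G` has weight one and its commutator subgroup does not have prime-power order. -/
def HasWeightOneAndNonprimepowCommutator (G : Type*) [Group G] : Prop :=
  (∃ g : G, Subgroup.normalClosure {g} = ⊤) ∧
    ¬ ∃ u k : ℕ, u.Prime ∧ Nat.card (commutator G) = u ^ k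

theorem HasWeightOneAndNonprimepowCommutator.of_mulEquiv {G H : Type*} [Group G] [Group H]
    (e : G ≃* H) (h : HasWeightOneAndNonprimepowCommutator G) :
    HasWeightOneAndNonprimepowCommutator H :=
  ⟨exists_normalClosure_singleton_eq_top_of_mulEquiv e h.1, card_commutator_congr e ▸ h.2⟩

theorem mul_ne_prime_pow (hq : q.Prime) (hr : r.Prime) (hqr : q < r) :
    ¬ ∃ u k : ℕ, u.Prime ∧ q * r = u ^ k := by
  rintro ⟨u, k, hu, h⟩
  have hqu : q = u := (Nat.prime_dvd_prime_iff_eq hq hu).mp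
    (hq.dvd_of_dvd_pow (h ▸ dvd_mul_right q r))
  have hru : r = u := (Nat.prime_dvd_prime_iff_eq hr hu).mp
    (hr.dvd_of_dvd_pow (h ▸ dvd_mul_left r q))
  exact hqr.ne (hqu.trans hru.symm)

theorem hasWeightOneAndNonprimepowCommutator_affineGroup {R : Type*} [CommRing R] [Fact p.Prime]
    (hR : ¬ ∃ u k : ℕ, u.Prime ∧ Nat.card R = u ^ k) {L : Subgroup Rˣ} (hL : Nat.card L = p)
    (h : ∃ u ∈ L, IsUnit ((u : R) - 1)) :
    HasWeightOneAndNonprimepowCommutator (AffineGroup L) := by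
  refine ⟨?_, ?_⟩
  · obtain ⟨u, hu, hu1⟩ := h
    refine ⟨_, AffineGroup.normalClosure_inr_eq_top hu (fun l hl => ?_) hu1⟩
    have hne : (⟨u, hu⟩ : L) ≠ 1 := by
      intro h1
      have : u = 1 := congrArg Subtype.val h1
      rw [this, Units.val_one, sub_self, isUnit_zero_iff] at hu1
      have := subsingleton_of_zero_eq_one hu1
      exact hR ⟨2, 0, Nat.prime_two, by simp⟩
    obtain ⟨n, hn⟩ := Subgroup.mem_zpowers_iff.mp
      (mem_zpowers_of_prime_card (g' := (⟨l, hl⟩ : L)) hL hne)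
    exact Subgroup.mem_zpowers_iff.mpr ⟨n, by simpa using congrArg Subtype.val hn⟩
  · rwa [AffineGroup.commutator_eq_range_inl h, AffineGroup.card_range_inl]

theorem HasWeightOneAndNonprimepowCommutator.exists_mulEquiv_affineGroup {G : Type*} [Group G]
    (h : HasWeightOneAndNonprimepowCommutator G) (hp : p.Prime) (hq : q.Prime) (hr : r.Prime)
    (hpq : p < q) (hqr : q < r) (hG : Nat.card G = p * q * r) :
    ∃ L : Subgroup (ZMod q × ZMod r)ˣ,
      (Nat.card L = p ∧ ∃ u ∈ L, IsUnit ((u : ZMod q × ZMod r) - 1)) ∧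
        Nonempty (G ≃* AffineGroup L) := by
  have := Fact.mk hp
  have : NeZero q := ⟨hq.ne_zero⟩
  have : NeZero r := ⟨hr.ne_zero⟩
  have hsq : Squarefree (Nat.card G) := hG ▸ squarefree_mul_mul hp hq hr hpq hqr
  have : Finite G := Nat.finite_of_card_ne_zero hsq.ne_zero
  have := IsZGroup.of_squarefree hsq
  have : IsCyclic (commutator G) := IsZGroup.isCyclic_commutator G
  have hR : Nat.card (ZMod q × ZMod r) = q * r := by
    rw [Nat.card_prod, Nat.card_zmod, Nat.card_zmod]
  have hc := card_commutator_eq_mul hp hq hr hpq hqr hG h.2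
  obtain ⟨L, hL, ⟨e⟩⟩ := _root_.exists_mulEquiv_affineGroup (G := G) (R := ZMod q × ZMod r) hp
    (natCast_surjective_zmod_prod ((Nat.coprime_primes hq hr).mpr hqr.ne))
    (by rw [hR, hG, mul_assoc]) (by rw [hR, hc])
    (by
      rw [hR]
      exact Nat.Coprime.mul_right ((Nat.coprime_primes hp hq).mpr hpq.ne)
        ((Nat.coprime_primes hp hr).mpr (hpq.trans hqr).ne))
    (by
      rw [hR]
      exact fun h => hr.one_lt.ne' (Nat.eq_one_of_mul_eq_one_left h))
  have : Nontrivial L := Finite.one_lt_card_iff_nontrivial.mp (hL ▸ hp.one_lt)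
  obtain ⟨u, hu⟩ := exists_ne (1 : L)
  refine ⟨L, ⟨hL, u, u.2, AffineGroup.isUnit_sub_one_of_card_commutator (L := L) (fun l hl => ?_)
    (by rw [← card_commutator_congr e, hc, hR])⟩, ⟨e⟩⟩
  obtain ⟨n, hn⟩ := Subgroup.mem_zpowers_iff.mp
    (mem_zpowers_of_prime_card (g' := (⟨l, hl⟩ : L)) hL hu)
  exact Subgroup.mem_zpowers_iff.mpr ⟨n, by simpa using congrArg Subtype.val hn⟩

theorem exists_group_mulEquiv {α H : Type*} [Group H] (e : α ≃ H) :
    ∃ s : Group α, Nonempty (@MulEquiv α H (groupMul s) _) :=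
  ⟨e.group, ⟨e.mulEquiv⟩⟩

theorem nonempty_mulEquiv_of_square {A B H K : Type*} {_ : Mul A} {_ : Mul B} {_ : Mul H}
    {_ : Mul K} (f : A ≃* B) (e : A ≃* H) (e' : B ≃* K) : Nonempty (H ≃* K) :=
  ⟨(e.symm.trans f).trans e'⟩

theorem nonempty_mulEquiv_of_cospan {A B H : Type*} {_ : Mul A} {_ : Mul B} {_ : Mul H}
    (e : A ≃* H) (e' : B ≃* H) : Nonempty (A ≃* B) :=
  ⟨e.trans e'.symm⟩

theorem HasWeightOneAndNonprimepowCommutator.of_groupMul_mulEquiv {α H : Type*} [Group H]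
    {s : Group α} (e : @MulEquiv α H (groupMul s) _)
    (h : HasWeightOneAndNonprimepowCommutator H) :
    @HasWeightOneAndNonprimepowCommutator α s :=
  h.of_mulEquiv (MulEquiv.symm e)

end Classification

/-- Let `p < q < r` be primes.  The number of isomorphism classes of groups of order
`p * q * r` that have weight one and whose commutator subgroup does not have
prime-power order equals `p - 1` if `p ∣ q - 1` and `p ∣ r - 1`, and `0` otherwise. -/
theorem stmt_9 {p q r : ℕ} (hp : p.Prime) (hq : q.Prime) (hr : r.Prime)
    (hpq : p < q) (hqr : q < r) :
    Nat.card (Quotient (isoSetoid (fun s : Group (Fin (p * q * r)) =>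
      letI := s
      (∃ g : Fin (p * q * r), Subgroup.normalClosure {g} = ⊤) ∧
      ¬ ∃ u k : ℕ, u.Prime ∧ Nat.card ↥(commutator (Fin (p * q * r))) = u ^ k))) =
    if p ∣ q - 1 ∧ p ∣ r - 1 then p - 1 else 0 := by
  have := Fact.mk hp
  have := Fact.mk hq
  have := Fact.mk hr
  have hR : Nat.card (ZMod q × ZMod r) = q * r := by
    rw [Nat.card_prod, Nat.card_zmod, Nat.card_zmod]
  have hcount := card_subgroup_isUnit_sub_one (ZMod q) (ZMod r) hp
  rw [Nat.card_zmod, Nat.card_zmod] at hcount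
  rw [← hcount]
  have hcard {L : Subgroup (ZMod q × ZMod r)ˣ} (hL : Nat.card L = p) :
      Nat.card (Fin (p * q * r)) = Nat.card (AffineGroup L) := by
    rw [SemidirectProduct.card, hL, Nat.card_fin]
    change _ = Nat.card (ZMod q × ZMod r) * p
    rw [hR]
    ring
  have transport {L : Subgroup (ZMod q × ZMod r)ˣ} (hL : Nat.card L = p) :
      ∃ s : Group (Fin (p * q * r)),
        Nonempty (@MulEquiv (Fin (p * q * r)) (AffineGroup L) (groupMul s) _) := by
    have : Finite L := Nat.finite_of_card_ne_zero (hL ▸ hp.ne_zero)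
    have : Finite (AffineGroup L) :=
      Nat.finite_of_card_ne_zero (by
        rw [← hcard hL, Nat.card_fin]
        exact mul_ne_zero (mul_ne_zero hp.ne_zero hq.ne_zero) hr.ne_zero)
    exact exists_group_mulEquiv (Finite.card_eq.mp (hcard hL)).some
  symm
  choose s hs using fun L : {L : Subgroup (ZMod q × ZMod r)ˣ //
    Nat.card L = p ∧ ∃ u ∈ L, IsUnit ((u : ZMod q × ZMod r) - 1)} => transport L.2.1
  have hsP (L) := HasWeightOneAndNonprimepowCommutator.of_groupMul_mulEquiv (hs L).some
    (hasWeightOneAndNonprimepowCommutator_affineGroup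
      (hR ▸ mul_ne_prime_pow hq hr hqr) L.2.1 L.2.2)
  have hsurj := natCast_surjective_zmod_prod ((Nat.coprime_primes hq hr).mpr hqr.ne)
  refine Nat.card_congr (Equiv.ofBijective
    (fun L => Quotient.mk _ ⟨s L, hsP L⟩) ⟨fun L L' h => ?_, fun x => ?_⟩)
  · obtain ⟨f⟩ := Quotient.exact h
    obtain ⟨E⟩ := nonempty_mulEquiv_of_square f (hs L).some (hs L').some
    exact Subtype.ext (le_antisymm (AffineGroup.le_of_mulEquiv hsurj L'.2.2 E)
      (AffineGroup.le_of_mulEquiv hsurj L.2.2 E.symm))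
  · induction x using Quotient.inductionOn with | h x =>
    obtain ⟨t, ht⟩ := x
    let _ := t
    obtain ⟨L, hL, ⟨e⟩⟩ := HasWeightOneAndNonprimepowCommutator.exists_mulEquiv_affineGroup
      (G := Fin (p * q * r)) ht hp hq hr hpq hqr (Nat.card_fin _)
    refine ⟨⟨L, hL⟩, Quotient.sound ?_⟩
    exact nonempty_mulEquiv_of_cospan (hs ⟨L, hL⟩).some e
end
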